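/- arXiv:1706.06568 — 3 statements merged into one kernel-verified Lean document; each statement's English description precedes it below -/
import Mathlib

section
/- Let N_T, N_S, N_A be positive integers with 1 ≤ N_A ≤ N_S ≤ N_T, let μ > 0 and s > 0. Let X_1, …, X_{N_T} be i.i.d. exponential random variables with mean μ, and let Y_1 ≤ Y_2 ≤ … ≤ Y_{N_T} denote their order statistics. Let B be a uniformly random subset of size N_A of the rank set T = {N_T−N_S+1, …, N_T}, independent of (X_1,…,X_{N_T}). Then P(∃ ξ ∈ B with Y_ξ < s) = ∑_{ξ=N_T−N_S+1}^{N_T−N_A+1} [C(N_T−ξ, N_A−1)/C(N_S, N_A)] · F_{(ξ)}(s), where F_{(ξ)}(s) = ∑_{n=ξ}^{N_T} C(N_T,n) (1 − e^{−s/μ})^n (e^{−s/μ})^{N_T−n}. -/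
open MeasureTheory ProbabilityTheory

/-- Discrete σ-algebra on finite subsets of ℕ. -/
instance : MeasurableSpace (Finset ℕ) := ⊤

/-- The CDF of the `ξ`-th smallest order statistic of `N_T` i.i.d. exponentials with mean `μ`. -/
noncomputable def FOrd (NT ξ : ℕ) (μ s : ℝ) : ℝ :=
  ∑ n ∈ Finset.Icc ξ NT,
    (NT.choose n : ℝ) * (1 - Real.exp (-s / μ)) ^ n * Real.exp (-s / μ) ^ (NT - n)

lemma expMeasure_real_Iio {r : ℝ} (hr : 0 < r) {x : ℝ} (hx : 0 ≤ x) :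
    (expMeasure r).real (Set.Iio x) = 1 - Real.exp (-(r * x)) := by
  have := isProbabilityMeasure_expMeasure hr
  have hac : expMeasure r ≪ volume := withDensity_absolutelyContinuous _ _
  rw [measureReal_congr (hac.ae_le Iio_ae_eq_Iic), ← cdf_eq_real, cdf_expMeasure_eq hr, if_pos hx]

open Classical in
/-- For i.i.d. coordinates, the number of coordinates landing in `A` has a binomial upper tail. -/
lemma pi_real_le_card_filter {ι α : Type*} [Fintype ι] [MeasurableSpace α] (ν : Measure α)
    [IsProbabilityMeasure ν] {A : Set α} (hA : MeasurableSet A) (k : ℕ) :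
    (Measure.pi fun _ : ι => ν).real {x | k ≤ (Finset.univ.filter fun i => x i ∈ A).card} =
      ∑ n ∈ Finset.Icc k (Fintype.card ι),
        ((Fintype.card ι).choose n : ℝ) * ν.real A ^ n * (1 - ν.real A) ^ (Fintype.card ι - n) := by
  let f : (ι → α) → Finset ι := fun x => Finset.univ.filter fun i => x i ∈ A
  have hf (S : Finset ι) : f ⁻¹' {S} = Set.univ.pi fun i => if i ∈ S then A else Aᶜ := by
    ext x
    simp only [f, Set.mem_preimage, Set.mem_singleton_iff, Finset.ext_iff, Finset.mem_filter,
      Finset.mem_univ, true_and, Set.mem_univ_pi]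
    refine forall_congr' fun i => ?_
    by_cases h : i ∈ S <;> simp [h]
  have hmeas (S : Finset ι) : MeasurableSet (f ⁻¹' {S}) := by
    rw [hf]
    refine MeasurableSet.univ_pi fun i => ?_
    split_ifs
    exacts [hA, hA.compl]
  have hval (S : Finset ι) : (Measure.pi fun _ : ι => ν).real (f ⁻¹' {S}) =
      ν.real A ^ S.card * (1 - ν.real A) ^ (Fintype.card ι - S.card) := by
    rw [hf, measureReal_def, Measure.pi_pi, ENNReal.toReal_prod]
    simp only [← measureReal_def, apply_ite ν.real, probReal_compl_eq_one_sub hA]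
    rw [Finset.prod_ite]
    simp [Finset.filter_not, ← Finset.compl_eq_univ_sdiff, Finset.card_compl]
  have hset : {x : ι → α | k ≤ (Finset.univ.filter fun i => x i ∈ A).card} =
      f ⁻¹' ↑(Finset.univ.filter fun S : Finset ι => k ≤ S.card) := by
    ext x
    simp [f]
  rw [hset, ← sum_measureReal_preimage_singleton _ fun S _ => hmeas S, Finset.sum_filter]
  simp only [hval]
  rw [← Finset.powerset_univ, Finset.sum_powerset_apply_card fun n =>
    if k ≤ n then ν.real A ^ n * (1 - ν.real A) ^ (Fintype.card ι - n) else 0]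
  simp only [Finset.card_univ, smul_ite, smul_zero, nsmul_eq_mul, ← mul_assoc]
  rw [← Finset.sum_filter]
  refine Finset.sum_congr ?_ fun _ _ => rfl
  ext n
  simp
  omega

lemma card_filter_isLeast_powersetCard {a b m ξ : ℕ} (hm : 1 ≤ m) (hξ : a ≤ ξ) (hb : ξ ≤ b)
    [DecidablePred fun B : Finset ℕ => IsLeast (B : Set ℕ) ξ] :
    (((Finset.Icc a b).powersetCard m).filter fun B : Finset ℕ => IsLeast (B : Set ℕ) ξ).card =
      (b - ξ).choose (m - 1) := by
  rw [← Nat.card_Ioc, ← Finset.card_powersetCard]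
  symm
  refine Finset.card_bij' (fun B _ => insert ξ B) (fun B _ => B.erase ξ) ?_ ?_ ?_ ?_
  · intro B hB
    rw [Finset.mem_powersetCard] at hB
    have hnot : ξ ∉ B := fun h => by simpa using hB.1 h
    simp only [Finset.mem_filter, Finset.mem_powersetCard, Finset.card_insert_of_notMem hnot, hB.2]
    refine ⟨⟨fun y hy => ?_, by omega⟩, by simp, fun y hy => ?_⟩
    · rcases Finset.mem_insert.1 hy with rfl | hy
      · simp [hξ, hb]
      · have := Finset.mem_Ioc.1 (hB.1 hy)
        simp; omega
    · rcases Finset.mem_insert.1 hy with rfl | hy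
      · exact le_rfl
      · exact (Finset.mem_Ioc.1 (hB.1 hy)).1.le
  · intro B hB
    simp only [Finset.mem_filter, Finset.mem_powersetCard] at hB ⊢
    obtain ⟨⟨hsub, hcard⟩, hmem, hlb⟩ := hB
    refine ⟨fun y hy => ?_, by rw [Finset.card_erase_of_mem (by exact_mod_cast hmem), hcard]⟩
    rw [Finset.mem_erase] at hy
    exact Finset.mem_Ioc.2
      ⟨lt_of_le_of_ne (hlb (by exact_mod_cast hy.2)) hy.1.symm, (Finset.mem_Icc.1 (hsub hy.2)).2⟩
  · intro B hB
    refine Finset.erase_insert fun h => ?_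
    simpa using (Finset.mem_powersetCard.1 hB).1 h
  · intro B hB
    exact Finset.insert_erase (by exact_mod_cast (Finset.mem_filter.1 hB).2.1)

instance : DiscreteMeasurableSpace (Finset ℕ) := ⟨fun _ => trivial⟩

open Classical in
/-- The least element of a uniformly random `m`-subset of `Icc a b`. -/
lemma uniformOn_powersetCard_isLeast (a b m ξ : ℕ) :
    uniformOn (((Finset.Icc a b).powersetCard m : Finset (Finset ℕ)) : Set (Finset ℕ))
      {B | IsLeast (B : Set ℕ) ξ} =
      ((((Finset.Icc a b).powersetCard m).filter
        fun B : Finset ℕ => IsLeast (B : Set ℕ) ξ).card : ENNReal) / ((b + 1 - a).choose m : ℕ) := by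
  rw [← uniformOn_inter_self (Finset.finite_toSet _)]
  have : (((Finset.Icc a b).powersetCard m : Finset (Finset ℕ)) : Set (Finset ℕ)) ∩
      {B | IsLeast (B : Set ℕ) ξ} =
      ↑(((Finset.Icc a b).powersetCard m).filter fun B : Finset ℕ => IsLeast (B : Set ℕ) ξ) := by
    ext B; simp
  rw [this, uniformOn_apply_finset, Finset.inter_eq_right.2 (Finset.filter_subset _ _),
    Finset.card_powersetCard, Nat.card_Icc]

/-- Lemma 1 of the paper: with `N_T` i.i.d. exponential gains (mean `μ`) with order statistics
`Y_1 ≤ … ≤ Y_{N_T}`, and `B` a uniformly random size-`N_A` subset of the rank set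
`T = {N_T−N_S+1,…,N_T}` independent of the gains (here `Y_ξ < s` is expressed as
`ξ ≤ #{i : X_i < s}`),
`P(∃ ξ ∈ B, Y_ξ < s) = ∑_ξ [C(N_T−ξ,N_A−1)/C(N_S,N_A)]·F_{(ξ)}(s)`. -/
theorem stmt_3 (NT NS NA : ℕ) (hNA : 1 ≤ NA) (hNS : NA ≤ NS) (hNT : NS ≤ NT)
    (μ s : ℝ) (hμ : 0 < μ) (hs : 0 < s) :
    ((Measure.pi (fun _ : Fin NT => expMeasure (1 / μ))).prod
        (uniformOn (((Finset.Icc (NT - NS + 1) NT).powersetCard NA : Finset (Finset ℕ)) :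
          Set (Finset ℕ))))
      {p : (Fin NT → ℝ) × Finset ℕ |
        ∃ ξ ∈ p.2, ξ ≤ (Finset.univ.filter (fun i => p.1 i < s)).card}
      = ENNReal.ofReal (∑ ξ ∈ Finset.Icc (NT - NS + 1) (NT - NA + 1),
          ((NT - ξ).choose (NA - 1) : ℝ) / (NS.choose NA : ℝ) * FOrd NT ξ μ s) := by
  classical
  have hr : 0 < 1 / μ := by positivity
  have := isProbabilityMeasure_expMeasure hr
  have hfin := Finset.finite_toSet ((Finset.Icc (NT - NS + 1) NT).powersetCard NA)
  have := isProbabilityMeasure_uniformOn hfin (by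
    rw [Finset.coe_nonempty, Finset.powersetCard_nonempty, Nat.card_Icc]; omega)
  have hF (ξ : ℕ) : (Measure.pi (fun _ : Fin NT => expMeasure (1 / μ))).real
      {x | ξ ≤ (Finset.univ.filter (fun i => x i < s)).card} = FOrd NT ξ μ s := by
    have h := pi_real_le_card_filter (ι := Fin NT) (expMeasure (1 / μ))
      (measurableSet_Iio (a := s)) ξ
    rw [expMeasure_real_Iio hr hs.le] at h
    rw [FOrd, neg_div, div_eq_mul_one_div s μ, mul_comm s]
    simpa using h
  have hmeas (ξ : ℕ) :
      MeasurableSet {x : Fin NT → ℝ | ξ ≤ (Finset.univ.filter (fun i => x i < s)).card} := by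
    simp only [Finset.card_filter]
    refine measurableSet_le measurable_const (Finset.measurable_fun_sum _ fun i _ => ?_)
    exact Measurable.ite (measurableSet_lt (measurable_pi_apply i) measurable_const)
      measurable_const measurable_const
  have hset : {p : (Fin NT → ℝ) × Finset ℕ |
        ∃ ξ ∈ p.2, ξ ≤ (Finset.univ.filter (fun i => p.1 i < s)).card} =
      ⋃ ξ : ℕ, {x : Fin NT → ℝ | ξ ≤ (Finset.univ.filter (fun i => x i < s)).card} ×ˢ
        {B : Finset ℕ | IsLeast (B : Set ℕ) ξ} := by
    ext ⟨x, B⟩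
    simp only [Set.mem_ofPred_eq, Set.mem_iUnion, Set.mem_prod]
    constructor
    · rintro ⟨ξ, hξ, hle⟩
      exact ⟨B.min' ⟨ξ, hξ⟩, (B.min'_le ξ hξ).trans hle, B.isLeast_min' _⟩
    · rintro ⟨ξ, hle, hξ⟩
      exact ⟨ξ, by exact_mod_cast hξ.1, hle⟩
  rw [hset, measure_iUnion (fun ξ η hne => Set.disjoint_left.2 fun p hp hq =>
      hne (hp.2.unique hq.2)) fun ξ => (hmeas ξ).prod (MeasurableSet.of_discrete),
    tsum_eq_sum (s := Finset.Icc (NT - NS + 1) (NT - NA + 1))]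
  · rw [ENNReal.ofReal_sum_of_nonneg fun ξ _ => by rw [← hF]; positivity]
    refine Finset.sum_congr rfl fun ξ hξ => ?_
    rw [Finset.mem_Icc] at hξ
    rw [Measure.prod_prod, uniformOn_powersetCard_isLeast,
      card_filter_isLeast_powersetCard hNA hξ.1 (show ξ ≤ NT by omega), ← hF,
      ENNReal.ofReal_mul (by positivity), ofReal_measureReal, mul_comm,
      ENNReal.ofReal_div_of_pos (by exact_mod_cast Nat.choose_pos hNS), ENNReal.ofReal_natCast,
      ENNReal.ofReal_natCast, show NT + 1 - (NT - NS + 1) = NS by omega]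
  · intro ξ hξ
    rw [Measure.prod_prod, (uniformOn_eq_zero_iff hfin).2, mul_zero]
    refine Set.eq_empty_of_forall_notMem fun B ⟨hB, hmem, hlb⟩ => hξ ?_
    rw [Finset.mem_coe, Finset.mem_powersetCard] at hB
    have hmin := Finset.mem_Icc.1 (hB.1 (by exact_mod_cast hmem))
    have hcard := Finset.card_le_card (show B ⊆ Finset.Icc ξ NT from fun y hy =>
      Finset.mem_Icc.2 ⟨hlb (by exact_mod_cast hy), (Finset.mem_Icc.1 (hB.1 hy)).2⟩)
    rw [hB.2, Nat.card_Icc] at hcard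
    rw [Finset.mem_Icc]
    omega
end

section
/- Let μ > 0, x > 0, and let N ≥ 1 and 1 ≤ ξ ≤ N be integers. Define the order-statistic density f_{(ξ)}(y) = [N!/((ξ−1)!(N−ξ)!)]·(1 − e^{−y/μ})^{ξ−1}·e^{−(N−ξ)y/μ}·(1/μ)e^{−y/μ}. Then ∫_0^∞ (x/2)·log₂(1+s)·f_{(ξ)}(x s) ds = [N!/((2 ln 2)(ξ−1)!(N−ξ)!)] · ∑_{b=0}^{ξ−1} C(ξ−1, b)·(−1)^b · e^{a_b}·E₁(a_b)/(N−ξ+1+b), where a_b = x(N−ξ+1+b)/μ and E₁(a) = ∫_a^∞ (e^{−u}/u) du. -/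
/-- The exponential integral `E₁(a) = ∫_a^∞ e^{−u}/u du`. -/
noncomputable def E₁ (a : ℝ) : ℝ := ∫ u in Set.Ioi a, Real.exp (-u) / u

/-- The density of the `ξ`-th smallest order statistic of `N` i.i.d. exponentials with
mean `μ`. -/
noncomputable def fOrd (N ξ : ℕ) (μ y : ℝ) : ℝ :=
  ((N.factorial : ℝ) / ((ξ - 1).factorial * (N - ξ).factorial))
    * (1 - Real.exp (-y / μ)) ^ (ξ - 1) * Real.exp (-(N - ξ : ℕ) * y / μ)
    * ((1 / μ) * Real.exp (-y / μ))

open MeasureTheory Set in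
theorem integrableOn_id_mul_exp_neg_mul {a : ℝ} (ha : 0 < a) :
    IntegrableOn (fun s : ℝ => s * Real.exp (-a * s)) (Ioi 0) := by
  simpa using integrableOn_rpow_mul_exp_neg_mul_rpow (s := 1) (p := 1) (by norm_num) one_pos ha

theorem Real.log_one_add_nonneg_and_le {s : ℝ} (hs : 0 < s) :
    0 ≤ Real.log (1 + s) ∧ Real.log (1 + s) ≤ s :=
  ⟨Real.log_nonneg (by linarith), by linarith [Real.log_le_sub_one_of_pos (by linarith : 0 < 1 + s)]⟩

open MeasureTheory Set in
theorem integrableOn_log_one_add_mul_exp_neg_mul {a : ℝ} (ha : 0 < a) :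
    IntegrableOn (fun s : ℝ => Real.log (1 + s) * Real.exp (-a * s)) (Ioi 0) := by
  refine (integrableOn_id_mul_exp_neg_mul ha).mono' (by fun_prop) ?_
  filter_upwards [ae_restrict_mem measurableSet_Ioi] with s hs
  obtain ⟨h0, h1⟩ := Real.log_one_add_nonneg_and_le hs
  rw [Real.norm_of_nonneg (by positivity)]
  gcongr

open MeasureTheory Set in
/-- The substitution `u = a (1 + s)` in the exponential integral. -/
theorem integral_exp_neg_mul_div_one_add {a : ℝ} (ha : 0 < a) :
    ∫ s in Ioi (0 : ℝ), Real.exp (-a * s) / (1 + s) = Real.exp a * E₁ a := by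
  have hscale := integral_comp_mul_left_Ioi' (fun u : ℝ => Real.exp (-u) / u) 1 ha
  have hshift := (measurePreserving_add_right volume (1 : ℝ)).setIntegral_preimage_emb
    (measurableEmbedding_addRight 1) (fun t : ℝ => Real.exp (-(a * t)) / (a * t)) (Ioi 1)
  rw [preimage_add_const_Ioi, sub_self] at hshift
  rw [mul_one] at hscale
  rw [E₁, ← hscale, ← hshift, smul_eq_mul, ← integral_const_mul, ← integral_const_mul]
  refine setIntegral_congr_fun measurableSet_Ioi fun s (hs : 0 < s) => ?_
  have hexp : Real.exp (-a * s) = Real.exp a * Real.exp (-(a * (s + 1))) := by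
    rw [← Real.exp_add]; ring_nf
  simp only [hexp]
  field_simp
  ring

open MeasureTheory Set Filter Topology in
theorem integral_log_one_add_mul_exp_neg_mul {a : ℝ} (ha : 0 < a) :
    ∫ s in Ioi (0 : ℝ), Real.log (1 + s) * Real.exp (-a * s) = Real.exp a / a * E₁ a := by
  have hu : ∀ s ∈ Ioi (0 : ℝ), HasDerivAt (fun s : ℝ => Real.log (1 + s)) (1 / (1 + s)) s :=
    fun s (hs : 0 < s) => ((hasDerivAt_id s).const_add 1).log (by simp only [id]; positivity)
  have hv : ∀ s ∈ Ioi (0 : ℝ),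
      HasDerivAt (fun s : ℝ => -Real.exp (-a * s) / a) (Real.exp (-a * s)) s := fun s _ => by
    convert! (((hasDerivAt_id s).const_mul (-a)).exp.neg.div_const a) using 1
    simp only [id]
    field_simp
  have hu'v : IntegrableOn
      ((fun s : ℝ => 1 / (1 + s)) * fun s : ℝ => -Real.exp (-a * s) / a) (Ioi 0) := by
    refine ((exp_neg_integrableOn_Ioi 0 ha).div_const a).mono'
      (Measurable.aestronglyMeasurable (by fun_prop)) ?_
    filter_upwards [ae_restrict_mem measurableSet_Ioi] with s (hs : 0 < s)
    rw [Pi.mul_apply, norm_mul, norm_div, norm_div, norm_neg, Real.norm_of_nonneg ha.le,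
      Real.norm_of_nonneg (Real.exp_pos _).le, norm_one, Real.norm_of_nonneg (by positivity)]
    exact mul_le_of_le_one_left (by positivity) (div_le_one_of_le₀ (by linarith) (by positivity))
  have hzero : Tendsto ((fun s : ℝ => Real.log (1 + s)) * fun s : ℝ => -Real.exp (-a * s) / a)
      (𝓝[>] 0) (𝓝 0) := by
    have hcont : ContinuousAt
        ((fun s : ℝ => Real.log (1 + s)) * fun s : ℝ => -Real.exp (-a * s) / a) 0 :=
      (ContinuousAt.log (by fun_prop) (by norm_num)).mul (by fun_prop)
    simpa [ContinuousAt] using hcont.tendsto.mono_left nhdsWithin_le_nhds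
  have hinfty : Tendsto ((fun s : ℝ => Real.log (1 + s)) * fun s : ℝ => -Real.exp (-a * s) / a)
      atTop (𝓝 0) := by
    have hlim := (tendsto_rpow_mul_exp_neg_mul_atTop_nhds_zero 1 a ha).div_const a
    rw [zero_div] at hlim
    refine squeeze_zero_norm' ?_ hlim
    filter_upwards [eventually_gt_atTop 0] with s hs
    obtain ⟨h0, h1⟩ := Real.log_one_add_nonneg_and_le hs
    rw [Pi.mul_apply, norm_mul, norm_div, norm_neg, Real.norm_of_nonneg ha.le,
      Real.norm_of_nonneg (Real.exp_pos _).le, Real.norm_of_nonneg h0, Real.rpow_one,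
      mul_div_assoc]
    gcongr
  rw [integral_Ioi_mul_deriv_eq_deriv_mul hu hv (integrableOn_log_one_add_mul_exp_neg_mul ha)
    hu'v hzero hinfty, sub_self, zero_sub, ← integral_neg, div_mul_eq_mul_div,
    ← integral_exp_neg_mul_div_one_add ha, ← integral_div]
  refine setIntegral_congr_fun measurableSet_Ioi fun s (hs : 0 < s) => ?_
  field_simp

/-- Binomial expansion of the order-statistic density into exponentials. -/
theorem fOrd_add_eq_sum (m n : ℕ) (μ y : ℝ) :
    fOrd (n + 1 + m) (n + 1) μ y
      = (((n + 1 + m).factorial : ℝ) / (n.factorial * m.factorial)) / μ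
          * ∑ b ∈ Finset.range (n + 1), (n.choose b : ℝ) * (-1) ^ b
              * Real.exp (-((m + 1 + b) * y / μ)) := by
  have hbinom : (1 - Real.exp (-y / μ)) ^ n
      = ∑ b ∈ Finset.range (n + 1), (n.choose b : ℝ) * (-1) ^ b * Real.exp (b * (-y / μ)) := by
    rw [sub_eq_neg_add, add_pow]
    refine Finset.sum_congr rfl fun b _ => ?_
    rw [neg_pow, Real.exp_nat_mul, one_pow]
    ring
  rw [fOrd, Nat.add_sub_cancel, Nat.add_sub_cancel_left, hbinom, Finset.mul_sum, Finset.mul_sum,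
    Finset.sum_mul, Finset.sum_mul]
  refine Finset.sum_congr rfl fun b _ => ?_
  have hexp : Real.exp (-((m + 1 + b) * y / μ))
      = Real.exp (b * (-y / μ)) * Real.exp (-m * y / μ) * Real.exp (-y / μ) := by
    rw [← Real.exp_add, ← Real.exp_add]
    ring_nf
  rw [hexp]
  ring

/-- Closed form for `∫_0^∞ (x/2)·log₂(1+s)·f_{(ξ)}(xs) ds` (the quantity `λ(ξ,x)` in the
average network capacity analysis). -/
theorem stmt_13 (μ x : ℝ) (hμ : 0 < μ) (hx : 0 < x) (N ξ : ℕ)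
    (hN : 1 ≤ N) (hξ1 : 1 ≤ ξ) (hξN : ξ ≤ N) :
    ∫ s in Set.Ioi (0 : ℝ), (x / 2) * Real.logb 2 (1 + s) * fOrd N ξ μ (x * s)
      = ((N.factorial : ℝ) / ((2 * Real.log 2) * (ξ - 1).factorial * (N - ξ).factorial))
          * ∑ b ∈ Finset.range ξ, ((ξ - 1).choose b : ℝ) * (-1) ^ b
              * Real.exp (x * (N - ξ + 1 + b) / μ) * E₁ (x * (N - ξ + 1 + b) / μ)
              / (N - ξ + 1 + b) := by
  obtain ⟨n, rfl⟩ : ∃ n, ξ = n + 1 := ⟨ξ - 1, by omega⟩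
  obtain ⟨m, rfl⟩ := Nat.exists_eq_add_of_le hξN
  set C : ℝ := ((n + 1 + m).factorial : ℝ) / (n.factorial * m.factorial) with hC
  have hrate : ∀ b : ℕ, 0 < x * (m + 1 + b) / μ := fun b => by positivity
  have hexpand : ∀ s : ℝ,
      (x / 2) * Real.logb 2 (1 + s) * fOrd (n + 1 + m) (n + 1) μ (x * s)
        = ∑ b ∈ Finset.range (n + 1), (x / 2 / Real.log 2 * C / μ * ((n.choose b : ℝ) * (-1) ^ b))
            * (Real.log (1 + s) * Real.exp (-(x * (m + 1 + b) / μ) * s)) := fun s => by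
    rw [fOrd_add_eq_sum, Finset.mul_sum, Finset.mul_sum, Real.logb]
    refine Finset.sum_congr rfl fun b _ => ?_
    rw [show -((m + 1 + b) * (x * s) / μ) = -(x * (m + 1 + b) / μ) * s by ring]
    ring
  simp_rw [hexpand]
  rw [MeasureTheory.integral_finsetSum _ fun b _ =>
      (integrableOn_log_one_add_mul_exp_neg_mul (hrate b)).const_mul _, Finset.mul_sum]
  refine Finset.sum_congr rfl fun b _ => ?_
  rw [MeasureTheory.integral_const_mul, integral_log_one_add_mul_exp_neg_mul (hrate b),
    Nat.add_sub_cancel, Nat.add_sub_cancel_left,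
    show ((n + 1 + m : ℕ) : ℝ) - ((n + 1 : ℕ) : ℝ) = m by push_cast; ring, hC]
  have hlog : Real.log 2 ≠ 0 := (Real.log_pos one_lt_two).ne'
  have hden : (m + 1 + b : ℝ) ≠ 0 := by positivity
  field_simp
end

section
/- Let μ_1, μ_2 > 0, x > 0, and let N ≥ 1 and 1 ≤ ξ, η ≤ N be integers. Let X^1_1, …, X^1_N be i.i.d. exponential with mean μ_1 and X^2_1, …, X^2_N be i.i.d. exponential with mean μ_2, the two families independent, with order statistics Y^1_{(ξ)} and Y^2_{(η)} denoting the ξ-th and η-th smallest values of the respective families. Then E[ (1/2)·log₂(1 + min(Y^1_{(ξ)}, Y^2_{(η)})/x) ] = λ_1(ξ, x) − ν_{1,2}(ξ, η, x) + λ_2(η, x) − ν_{2,1}(η, ξ, x), where for i ∈ {1,2}: λ_i(ζ, x) = [N!/((2 ln 2)(ζ−1)!(N−ζ)!)] ∑_{b=0}^{ζ−1} C(ζ−1,b)(−1)^b e^{a_b} E₁(a_b)/(N−ζ+1+b) with a_b = x(N−ζ+1+b)/μ_i, and for (i,j) ∈ {(1,2),(2,1)}: ν_{i,j}(ζ, ϑ,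 x) = [N!/((2 ln 2)(ζ−1)!(N−ζ)!)] ∑_{n=ϑ}^{N} ∑_{d=0}^{n} ∑_{b=0}^{ζ−1} C(N,n)C(n,d)C(ζ−1,b)(−1)^{b+d} e^{xκ} E₁(xκ)/(μ_i κ) with κ = (N−ζ+1+b)/μ_i + (N−n+d)/μ_j, and E₁(a) = ∫_a^∞ (e^{−u}/u) du. -/
open MeasureTheory ProbabilityTheory

/-- The `ξ`-th smallest value of the tuple `ω` (`ξ` is 1-indexed): the infimum of all `y`
such that at least `ξ` of the values are `≤ y`. -/
noncomputable def orderStat {N : ℕ} (ω : Fin N → ℝ) (ξ : ℕ) : ℝ :=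
  sInf {y : ℝ | ξ ≤ (Finset.univ.filter fun i => ω i ≤ y).card}

/-- `λ_i(ζ,x)` of the paper's capacity analysis (with hop mean `μ`). -/
noncomputable def lam (N : ℕ) (μ x : ℝ) (ζ : ℕ) : ℝ :=
  (N.factorial : ℝ) / ((2 * Real.log 2) * (ζ - 1).factorial * (N - ζ).factorial)
    * ∑ b ∈ Finset.range ζ, ((ζ - 1).choose b : ℝ) * (-1) ^ b
        * Real.exp (x * (N - ζ + 1 + b) / μ) * E₁ (x * (N - ζ + 1 + b) / μ)
        / (N - ζ + 1 + b)

/-- `ν_{i,j}(ζ,ϑ,x)` of the paper's capacity analysis (with hop means `μi`, `μj`). -/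
noncomputable def nu (N : ℕ) (μi μj x : ℝ) (ζ ϑ : ℕ) : ℝ :=
  (N.factorial : ℝ) / ((2 * Real.log 2) * (ζ - 1).factorial * (N - ζ).factorial)
    * ∑ n ∈ Finset.Icc ϑ N, ∑ d ∈ Finset.range (n + 1), ∑ b ∈ Finset.range ζ,
        (N.choose n : ℝ) * (n.choose d : ℝ) * ((ζ - 1).choose b : ℝ) * (-1) ^ (b + d)
          * Real.exp (x * ((N - ζ + 1 + b) / μi + (N - n + d) / μj))
          * E₁ (x * ((N - ζ + 1 + b) / μi + (N - n + d) / μj))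
          / (μi * ((N - ζ + 1 + b) / μi + (N - n + d) / μj))

/-- The probability that a binomial variable with parameters `N` and `p` is at least `k`. -/
noncomputable def binomialTail (N k : ℕ) (p : ℝ) : ℝ :=
  ∑ n ∈ Finset.Icc k N, (N.choose n : ℝ) * p ^ n * (1 - p) ^ (N - n)

lemma binomialTail_eq_eval (N k : ℕ) (p : ℝ) :
    binomialTail N k p = (∑ n ∈ Finset.Icc k N, bernsteinPolynomial ℝ N n).eval p := by
  simp [binomialTail, bernsteinPolynomial, Polynomial.eval_finsetSum]

lemma hasDerivAt_binomialTail {N k : ℕ} (hk : 1 ≤ k) (hkN : k ≤ N) (p : ℝ) :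
    HasDerivAt (binomialTail N k)
      ((N.factorial : ℝ) / ((k - 1).factorial * (N - k).factorial)
        * (p ^ (k - 1) * (1 - p) ^ (N - k))) p := by
  obtain ⟨j, rfl⟩ : ∃ j, k = j + 1 := ⟨k - 1, by omega⟩
  obtain ⟨M, rfl⟩ : ∃ M, N = M + 1 := ⟨N - 1, by omega⟩
  have hjM : j ≤ M := by omega
  have h := (∑ n ∈ Finset.Icc (j + 1) (M + 1), bernsteinPolynomial ℝ (M + 1) n).hasDerivAt p
  rw [← funext (binomialTail_eq_eval (M + 1) (j + 1))] at h
  refine h.congr_deriv ?_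
  have hIcc : Finset.Icc (j + 1) (M + 1) = Finset.Ico (j + 1) (M + 1 + 1) := by
    ext; simp
  rw [Polynomial.derivative_sum, hIcc, ← Finset.sum_Ico_add' _ j (M + 1) 1]
  simp_rw [bernsteinPolynomial.derivative_succ]
  rw [← Finset.mul_sum]
  have htel : ∑ i ∈ Finset.Ico j (M + 1),
      (bernsteinPolynomial ℝ (M + 1 - 1) i - bernsteinPolynomial ℝ (M + 1 - 1) (i + 1))
      = bernsteinPolynomial ℝ M j := by
    have := Finset.sum_Ico_sub (fun i => bernsteinPolynomial ℝ M i) (show j ≤ M + 1 by omega)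
    rw [← neg_inj, ← Finset.sum_neg_distrib]
    simp only [neg_sub, Nat.add_sub_cancel]
    rw [this, bernsteinPolynomial.eq_zero_of_lt ℝ (Nat.lt_succ_self M), zero_sub]
  rw [htel]
  simp only [bernsteinPolynomial, Polynomial.eval_mul, Polynomial.eval_natCast,
    Polynomial.eval_pow, Polynomial.eval_X, Polynomial.eval_sub, Polynomial.eval_one,
    Nat.add_sub_cancel, Nat.add_sub_add_right, Nat.cast_choose ℝ hjM, Nat.factorial_succ]
  push_cast
  ring

lemma binomialTail_zero {N k : ℕ} (hk : 1 ≤ k) : binomialTail N k 0 = 0 := by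
  refine Finset.sum_eq_zero fun n hn => ?_
  rw [Finset.mem_Icc] at hn
  rw [zero_pow (by omega)]
  ring

lemma one_sub_binomialTail {N k : ℕ} (hkN : k ≤ N) (p : ℝ) :
    1 - binomialTail N k p
      = ∑ n ∈ Finset.range k, (N.choose n : ℝ) * p ^ n * (1 - p) ^ (N - n) := by
  have hIcc : Finset.Icc k N = Finset.Ico k (N + 1) := by ext; simp
  rw [binomialTail, hIcc, sub_eq_iff_eq_add, Finset.sum_range_add_sum_Ico _ (by omega)]
  calc (1 : ℝ) = (p + (1 - p)) ^ N := by rw [add_sub_cancel, one_pow]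
    _ = ∑ n ∈ Finset.range (N + 1), (N.choose n : ℝ) * p ^ n * (1 - p) ^ (N - n) := by
        rw [add_pow]
        exact Finset.sum_congr rfl fun n _ => by ring

lemma binomialTail_nonneg {N k : ℕ} {p : ℝ} (h0 : 0 ≤ p) (h1 : p ≤ 1) :
    0 ≤ binomialTail N k p :=
  Finset.sum_nonneg fun n _ => by
    have := sub_nonneg.mpr h1
    positivity

lemma binomialTail_le_one {N k : ℕ} (hkN : k ≤ N) {p : ℝ} (h0 : 0 ≤ p) (h1 : p ≤ 1) :
    binomialTail N k p ≤ 1 := by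
  rw [← sub_nonneg, one_sub_binomialTail hkN]
  exact Finset.sum_nonneg fun n _ => by
    have := sub_nonneg.mpr h1
    positivity

lemma one_sub_binomialTail_le {N k : ℕ} (hkN : k ≤ N) {p : ℝ} (h0 : 0 ≤ p) (h1 : p ≤ 1) :
    1 - binomialTail N k p ≤ 2 ^ N * (1 - p) := by
  have hq := sub_nonneg.mpr h1
  rw [one_sub_binomialTail hkN]
  calc ∑ n ∈ Finset.range k, (N.choose n : ℝ) * p ^ n * (1 - p) ^ (N - n)
      ≤ ∑ n ∈ Finset.range k, (N.choose n : ℝ) * (1 - p) := by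
        refine Finset.sum_le_sum fun n hn => ?_
        rw [Finset.mem_range] at hn
        rw [mul_assoc]
        refine mul_le_mul_of_nonneg_left ?_ (Nat.cast_nonneg _)
        have hpow : (1 - p) ^ (N - n) ≤ 1 - p :=
          pow_le_of_le_one hq (by linarith) (by omega)
        calc p ^ n * (1 - p) ^ (N - n) ≤ 1 * (1 - p) :=
              mul_le_mul (pow_le_one₀ h0 h1) hpow (by positivity) zero_le_one
          _ = 1 - p := one_mul _
    _ ≤ ∑ n ∈ Finset.range (N + 1), (N.choose n : ℝ) * (1 - p) :=
        Finset.sum_le_sum_of_subset_of_nonneg (Finset.range_mono (by omega))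
          fun n _ _ => by positivity
    _ = 2 ^ N * (1 - p) := by
        rw [← Finset.sum_mul]
        exact_mod_cast congrArg (fun m : ℕ => (m : ℝ) * (1 - p)) (Nat.sum_range_choose N)

section OrderStatistics

variable {N k : ℕ}

lemma le_card_filter_le_iff (ω : Fin N → ℝ) (t : ℝ) :
    k ≤ (Finset.univ.filter fun i => ω i ≤ t).card
      ↔ ∃ S : Finset (Fin N), k ≤ S.card ∧ ∀ i ∈ S, ω i ≤ t := by
  refine ⟨fun h => ⟨_, h, fun i hi => (Finset.mem_filter.mp hi).2⟩, ?_⟩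
  rintro ⟨S, hS, hSt⟩
  exact hS.trans (Finset.card_le_card fun i hi => by simpa using hSt i hi)

lemma orderStat_le_iff (hk : 1 ≤ k) (hkN : k ≤ N) (ω : Fin N → ℝ) (t : ℝ) :
    orderStat ω k ≤ t ↔ k ≤ (Finset.univ.filter fun i => ω i ≤ t).card := by
  set A : Set ℝ := {y | k ≤ (Finset.univ.filter fun i => ω i ≤ y).card} with hA
  have hA' : A = ⋃ S ∈ {S : Finset (Fin N) | k ≤ S.card}, ⋂ i ∈ S, Set.Ici (ω i) := by
    ext y
    simp [hA, le_card_filter_le_iff]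
  have hclosed : IsClosed A := by
    rw [hA']
    exact (Set.toFinite _).isClosed_biUnion fun S _ =>
      isClosed_biInter fun i _ => isClosed_Ici
  have hbdd : BddBelow A := by
    obtain ⟨m, hm⟩ := (Set.finite_range ω).bddBelow
    refine ⟨m, fun y hy => ?_⟩
    have hpos : 0 < (Finset.univ.filter fun i => ω i ≤ y).card := hk.trans hy
    obtain ⟨i, hi⟩ := Finset.card_pos.mp hpos
    exact (hm ⟨i, rfl⟩).trans (Finset.mem_filter.mp hi).2
  have hne : A.Nonempty := by
    obtain ⟨m, hm⟩ := (Set.finite_range ω).bddAbove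
    refine ⟨m, ?_⟩
    simpa [hA, Finset.filter_true_of_mem fun i _ => hm ⟨i, rfl⟩] using hkN
  constructor
  · intro h
    have hmem : k ≤ (Finset.univ.filter fun i => ω i ≤ orderStat ω k).card :=
      hclosed.csInf_mem hne hbdd
    exact hmem.trans (Finset.card_le_card
      (Finset.monotone_filter_right _ fun i _ hi => le_trans hi h))
  · intro h
    exact csInf_le hbdd h

lemma measurable_orderStat (hk : 1 ≤ k) (hkN : k ≤ N) :
    Measurable fun ω : Fin N → ℝ => orderStat ω k := by
  refine measurable_of_Iic fun t => ?_
  have : (fun ω : Fin N → ℝ => orderStat ω k) ⁻¹' Set.Iic t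
      = ⋃ S ∈ {S : Finset (Fin N) | k ≤ S.card}, ⋂ i ∈ S, {ω | ω i ≤ t} := by
    ext ω
    simp [orderStat_le_iff hk hkN, le_card_filter_le_iff]
  rw [this]
  exact (Set.toFinite _).measurableSet_biUnion fun S _ =>
    S.measurableSet_biInter fun i _ => measurableSet_le (measurable_pi_apply i) measurable_const

lemma measureReal_orderStat_le (hk : 1 ≤ k) (hkN : k ≤ N) (P : Measure ℝ)
    [IsProbabilityMeasure P] (t : ℝ) :
    (Measure.pi fun _ : Fin N => P).real {ω | orderStat ω k ≤ t}
      = binomialTail N k (P.real (Set.Iic t)) := by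
  classical
  have hcell : ∀ S : Finset (Fin N), {ω : Fin N → ℝ | (Finset.univ.filter fun i => ω i ≤ t) = S}
      = Set.univ.pi fun i => if i ∈ S then Set.Iic t else Set.Ioi t := by
    intro S
    ext ω
    simp only [Set.mem_ofPred_eq, Finset.ext_iff, Finset.mem_filter, Finset.mem_univ, true_and,
      Set.mem_univ_pi]
    refine forall_congr' fun i => ?_
    by_cases hi : i ∈ S <;> simp [hi]
  have hcell_meas : ∀ S : Finset (Fin N),
      MeasurableSet {ω : Fin N → ℝ | (Finset.univ.filter fun i => ω i ≤ t) = S} := by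
    intro S
    rw [hcell]
    refine MeasurableSet.univ_pi fun i => ?_
    split_ifs
    exacts [measurableSet_Iic, measurableSet_Ioi]
  have hcell_prob : ∀ S : Finset (Fin N),
      (Measure.pi fun _ : Fin N => P).real {ω | (Finset.univ.filter fun i => ω i ≤ t) = S}
        = P.real (Set.Iic t) ^ S.card * (1 - P.real (Set.Iic t)) ^ (N - S.card) := by
    intro S
    have hcompl : P.real (Set.Ioi t) = 1 - P.real (Set.Iic t) := by
      rw [← Set.compl_Iic, probReal_compl_eq_one_sub measurableSet_Iic]
    rw [hcell, Measure.real, Measure.pi_pi, ENNReal.toReal_prod]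
    have : ∀ i, (P (if i ∈ S then Set.Iic t else Set.Ioi t)).toReal
        = if i ∈ S then P.real (Set.Iic t) else 1 - P.real (Set.Iic t) := by
      intro i
      split_ifs
      exacts [rfl, hcompl]
    simp_rw [this]
    rw [Finset.prod_ite]
    simp [Finset.filter_not, Finset.card_sdiff]
  have hevent : {ω : Fin N → ℝ | orderStat ω k ≤ t}
      = ⋃ S ∈ Finset.univ.filter fun S : Finset (Fin N) => k ≤ S.card,
        {ω | (Finset.univ.filter fun i => ω i ≤ t) = S} := by
    ext ω
    simp [orderStat_le_iff hk hkN]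
  rw [hevent, measureReal_biUnion_finset _ fun S _ => hcell_meas S]
  · simp_rw [hcell_prob]
    rw [Finset.sum_filter, ← Finset.powerset_univ]
    rw [Finset.sum_powerset_apply_card fun n => if k ≤ n then
      P.real (Set.Iic t) ^ n * (1 - P.real (Set.Iic t)) ^ (N - n) else 0]
    simp only [Finset.card_univ, Fintype.card_fin, nsmul_eq_mul, mul_ite, mul_zero]
    rw [← Finset.sum_filter, binomialTail]
    refine Finset.sum_congr ?_ fun n _ => by ring
    ext n
    simp
    omega
  · intro S _ T _ hST
    refine Set.disjoint_left.mpr fun ω hS hT => hST ?_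
    exact hS.symm.trans hT

end OrderStatistics

section LogExpIntegral

variable {x κ : ℝ}

lemma log_one_add_div_nonneg (hx : 0 < x) {t : ℝ} (ht : 0 ≤ t) : 0 ≤ Real.log (1 + t / x) :=
  Real.log_nonneg (by have := div_nonneg ht hx.le; linarith)

lemma log_one_add_div_le (hx : 0 < x) {t : ℝ} (ht : 0 ≤ t) : Real.log (1 + t / x) ≤ t / x := by
  have := Real.log_le_sub_one_of_pos (show 0 < 1 + t / x by positivity)
  linarith

lemma hasDerivAt_log_one_add_div (hx : 0 < x) {t : ℝ} (ht : 0 ≤ t) :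
    HasDerivAt (fun s => Real.log (1 + s / x)) (1 / (x + t)) t := by
  have h := (((hasDerivAt_id t).div_const x).const_add 1).log (by simp; positivity)
  refine h.congr_deriv ?_
  simp only [id]
  field_simp

lemma tendsto_log_mul_exp_neg_atTop (hx : 0 < x) (hκ : 0 < κ) :
    Filter.Tendsto (fun t => Real.log (1 + t / x) * Real.exp (-(κ * t))) Filter.atTop (nhds 0) := by
  have h := (Real.tendsto_pow_mul_exp_neg_atTop_nhds_zero 1).comp
    (Filter.tendsto_id.const_mul_atTop hκ)
  have h' := h.const_mul (1 / (x * κ))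
  rw [mul_zero] at h'
  refine squeeze_zero' ?_ ?_ h'
  · filter_upwards [Filter.eventually_ge_atTop 0] with t ht
    exact mul_nonneg (log_one_add_div_nonneg hx ht) (Real.exp_pos _).le
  · filter_upwards [Filter.eventually_ge_atTop 0] with t ht
    calc Real.log (1 + t / x) * Real.exp (-(κ * t)) ≤ t / x * Real.exp (-(κ * t)) :=
          mul_le_mul_of_nonneg_right (log_one_add_div_le hx ht) (Real.exp_pos _).le
      _ = _ := by
        simp only [Function.comp, id, pow_one]
        field_simp

lemma integrableOn_exp_neg_mul (hκ : 0 < κ) :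
    IntegrableOn (fun t => Real.exp (-(κ * t))) (Set.Ioi 0) := by
  simpa only [neg_mul] using exp_neg_integrableOn_Ioi 0 hκ

lemma integrableOn_exp_neg_mul_div_add (hx : 0 < x) (hκ : 0 < κ) :
    IntegrableOn (fun t => Real.exp (-(κ * t)) / (x + t)) (Set.Ioi 0) := by
  refine ((integrableOn_exp_neg_mul hκ).const_mul x⁻¹).mono'
    (Measurable.aestronglyMeasurable (by fun_prop)) ?_
  refine (ae_restrict_iff' measurableSet_Ioi).mpr (.of_forall fun t ht => ?_)
  have ht' : 0 < t := ht
  rw [Real.norm_of_nonneg (by positivity), div_eq_inv_mul]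
  gcongr
  linarith

lemma integrableOn_log_mul_exp_neg (hx : 0 < x) (hκ : 0 < κ) :
    IntegrableOn (fun t => Real.log (1 + t / x) * Real.exp (-(κ * t))) (Set.Ioi 0) := by
  have h := integrableOn_rpow_mul_exp_neg_mul_rpow (p := 1) (s := 1) (by norm_num) one_pos hκ
  refine (h.const_mul x⁻¹).mono' (by fun_prop) ?_
  refine (ae_restrict_iff' measurableSet_Ioi).mpr (.of_forall fun t ht => ?_)
  have ht' : 0 ≤ t := le_of_lt ht
  have hlog := log_one_add_div_nonneg hx ht'
  rw [Real.norm_of_nonneg (by positivity), Real.rpow_one, neg_mul, ← mul_assoc, ← div_eq_inv_mul]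
  exact mul_le_mul_of_nonneg_right (log_one_add_div_le hx ht') (Real.exp_pos _).le

lemma integral_exp_neg_mul_div_add (hκ : 0 < κ) :
    ∫ t in Set.Ioi 0, Real.exp (-(κ * t)) / (x + t) = Real.exp (x * κ) * E₁ (x * κ) := by
  have hscale := integral_comp_mul_left_Ioi (fun u => Real.exp (-u) / u) x hκ
  have hshift := (measurePreserving_add_left volume x).setIntegral_preimage_emb
    (measurableEmbedding_addLeft x) (fun v => Real.exp (-(κ * v)) / (κ * v)) (Set.Ioi x)
  rw [Set.preimage_const_add_Ioi, sub_self] at hshift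
  rw [hscale, smul_eq_mul, mul_comm κ x] at hshift
  have hE : E₁ (x * κ) = κ * ∫ t in Set.Ioi 0, Real.exp (-(κ * (x + t))) / (κ * (x + t)) := by
    rw [hshift, mul_inv_cancel_left₀ hκ.ne', E₁]
  rw [hE, ← mul_assoc, ← integral_const_mul]
  congr 1 with t
  rw [show -(κ * (x + t)) = -(κ * t) - x * κ by ring, Real.exp_sub, mul_comm κ (x + t)]
  field_simp

lemma integral_log_mul_exp_neg (hx : 0 < x) (hκ : 0 < κ) :
    ∫ t in Set.Ioi 0, Real.log (1 + t / x) * Real.exp (-(κ * t))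
      = Real.exp (x * κ) * E₁ (x * κ) / κ := by
  have hderiv : ∀ t ∈ Set.Ici (0 : ℝ),
      HasDerivAt (fun t => Real.log (1 + t / x) * Real.exp (-(κ * t)))
        (Real.exp (-(κ * t)) / (x + t) - κ * (Real.log (1 + t / x) * Real.exp (-(κ * t)))) t := by
    intro t ht
    refine ((hasDerivAt_log_one_add_div hx ht).mul
      ((hasDerivAt_id t).const_mul κ).neg.exp).congr_deriv ?_
    simp only [id, Pi.neg_apply]
    ring_nf
  have hint1 := integrableOn_exp_neg_mul_div_add hx hκ
  have hint2 := (integrableOn_log_mul_exp_neg hx hκ).const_mul κ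
  have h := integral_Ioi_of_hasDerivAt_of_tendsto
    (hderiv 0 Set.self_mem_Ici).continuousAt.continuousWithinAt
    (fun t ht => hderiv t (Set.Ioi_subset_Ici_self ht)) (hint1.sub hint2)
    (tendsto_log_mul_exp_neg_atTop hx hκ)
  rw [integral_sub hint1 hint2, integral_const_mul, integral_exp_neg_mul_div_add hκ] at h
  simp only [zero_div, add_zero, Real.log_one, zero_mul, sub_zero] at h
  rw [eq_div_iff hκ.ne']
  linarith

lemma integral_log_mul_sum_exp_neg {ι : Type*} (hx : 0 < x) (s : Finset ι) (c κ : ι → ℝ)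
    (hκ : ∀ i ∈ s, 0 < κ i) :
    IntegrableOn (fun t => Real.log (1 + t / x) * ∑ i ∈ s, c i * Real.exp (-(κ i * t)))
        (Set.Ioi 0) ∧
      ∫ t in Set.Ioi 0, Real.log (1 + t / x) * ∑ i ∈ s, c i * Real.exp (-(κ i * t))
        = ∑ i ∈ s, c i * (Real.exp (x * κ i) * E₁ (x * κ i) / κ i) := by
  have hint : ∀ i ∈ s, IntegrableOn
      (fun t => c i * (Real.log (1 + t / x) * Real.exp (-(κ i * t)))) (Set.Ioi 0) :=
    fun i hi => (integrableOn_log_mul_exp_neg hx (hκ i hi)).const_mul (c i)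
  simp_rw [Finset.mul_sum, mul_left_comm (Real.log _)]
  refine ⟨integrable_finsetSum s hint, ?_⟩
  rw [integral_finsetSum s hint]
  refine Finset.sum_congr rfl fun i hi => ?_
  rw [integral_const_mul, integral_log_mul_exp_neg hx (hκ i hi)]

end LogExpIntegral

section ExponentialOrderStatistics

/-- The density at `t` of the `k`-th smallest of `N` i.i.d. exponential variables of mean `μ`. -/
noncomputable def expOrderDensity (N k : ℕ) (μ t : ℝ) : ℝ :=
  (N.factorial : ℝ) / ((k - 1).factorial * (N - k).factorial)
    * ((1 - Real.exp (-(t / μ))) ^ (k - 1) * Real.exp (-(t / μ)) ^ (N - k))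
    * (Real.exp (-(t / μ)) / μ)

/-- The distribution function at `t ≥ 0` of the `k`-th smallest of `N` i.i.d. exponential
variables of mean `μ`. -/
noncomputable def expOrderCdf (N k : ℕ) (μ t : ℝ) : ℝ :=
  binomialTail N k (1 - Real.exp (-(t / μ)))

variable {N k l : ℕ} {μ μ' x t : ℝ}

lemma exp_neg_div_mem_Icc (hμ : 0 < μ) (ht : 0 ≤ t) :
    0 ≤ 1 - Real.exp (-(t / μ)) ∧ 1 - Real.exp (-(t / μ)) ≤ 1 := by
  have h1 : Real.exp (-(t / μ)) ≤ 1 := Real.exp_le_one_iff.mpr (neg_nonpos.mpr (by positivity))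
  have h0 := Real.exp_pos (-(t / μ))
  constructor <;> linarith

lemma hasDerivAt_expOrderCdf (hk : 1 ≤ k) (hkN : k ≤ N) (t : ℝ) :
    HasDerivAt (expOrderCdf N k μ) (expOrderDensity N k μ t) t := by
  have hF : HasDerivAt (fun s => 1 - Real.exp (-(s / μ))) (Real.exp (-(t / μ)) / μ) t := by
    refine (((hasDerivAt_id t).div_const μ).neg.exp.const_sub 1).congr_deriv ?_
    simp only [id, Pi.neg_apply]
    ring
  refine ((hasDerivAt_binomialTail hk hkN _).comp t hF).congr_deriv ?_
  rw [expOrderDensity, sub_sub_cancel]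

lemma expOrderCdf_zero (hk : 1 ≤ k) : expOrderCdf N k μ 0 = 0 := by
  simp [expOrderCdf, binomialTail_zero hk]

lemma one_sub_expOrderCdf_mem_Icc (hμ : 0 < μ) (hkN : k ≤ N) (ht : 0 ≤ t) :
    1 - expOrderCdf N k μ t ∈ Set.Icc 0 1 := by
  obtain ⟨h0, h1⟩ := exp_neg_div_mem_Icc hμ ht
  have hnn : 0 ≤ expOrderCdf N k μ t := binomialTail_nonneg h0 h1
  have hle : expOrderCdf N k μ t ≤ 1 := binomialTail_le_one hkN h0 h1
  constructor <;> linarith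

lemma one_sub_expOrderCdf_le (hμ : 0 < μ) (hkN : k ≤ N) (ht : 0 ≤ t) :
    1 - expOrderCdf N k μ t ≤ 2 ^ N * Real.exp (-(1 / μ * t)) := by
  obtain ⟨h0, h1⟩ := exp_neg_div_mem_Icc hμ ht
  refine (one_sub_binomialTail_le hkN h0 h1).trans_eq ?_
  rw [sub_sub_cancel, one_div_mul_eq_div]

lemma one_sub_pow_eq_sum (e : ℝ) (n : ℕ) :
    (1 - e) ^ n = ∑ d ∈ Finset.range (n + 1), (n.choose d : ℝ) * (-1) ^ d * e ^ d := by
  rw [sub_eq_neg_add, add_pow]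
  refine Finset.sum_congr rfl fun d _ => ?_
  rw [neg_pow, one_pow]
  ring

lemma expOrderDensity_eq_sum (hk : 1 ≤ k) (hkN : k ≤ N) (t : ℝ) :
    expOrderDensity N k μ t = ∑ b ∈ Finset.range k,
      (N.factorial : ℝ) / ((k - 1).factorial * (N - k).factorial)
        * (((k - 1).choose b : ℝ) * (-1) ^ b / μ)
        * Real.exp (-(((N : ℝ) - k + 1 + b) / μ * t)) := by
  rw [expOrderDensity, one_sub_pow_eq_sum, Nat.sub_add_cancel hk, Finset.sum_mul, Finset.mul_sum,
    Finset.sum_mul]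
  refine Finset.sum_congr rfl fun b _ => ?_
  have hexp : Real.exp (-(((N : ℝ) - k + 1 + b) / μ * t))
      = Real.exp (-(t / μ)) ^ b * Real.exp (-(t / μ)) ^ (N - k) * Real.exp (-(t / μ)) := by
    rw [← pow_add, ← pow_succ, ← Real.exp_nat_mul]
    push_cast [Nat.cast_sub hkN]
    ring_nf
  rw [hexp]
  ring

lemma expOrderCdf_eq_sum (t : ℝ) :
    expOrderCdf N l μ t = ∑ n ∈ Finset.Icc l N, ∑ d ∈ Finset.range (n + 1),
      (N.choose n : ℝ) * (n.choose d : ℝ) * (-1) ^ d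
        * Real.exp (-(((N : ℝ) - n + d) / μ * t)) := by
  rw [expOrderCdf, binomialTail]
  refine Finset.sum_congr rfl fun n hn => ?_
  have hnN := (Finset.mem_Icc.mp hn).2
  rw [one_sub_pow_eq_sum, sub_sub_cancel, Finset.mul_sum, Finset.sum_mul]
  refine Finset.sum_congr rfl fun d _ => ?_
  have hexp : Real.exp (-(((N : ℝ) - n + d) / μ * t))
      = Real.exp (-(t / μ)) ^ d * Real.exp (-(t / μ)) ^ (N - n) := by
    rw [← pow_add, ← Real.exp_nat_mul]
    push_cast [Nat.cast_sub hnN]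
    ring_nf
  rw [hexp]
  ring

lemma integral_log_mul_expOrderDensity (hx : 0 < x) (hμ : 0 < μ) (hk : 1 ≤ k) (hkN : k ≤ N) :
    IntegrableOn (fun t => Real.log (1 + t / x) * expOrderDensity N k μ t) (Set.Ioi 0) ∧
      ∫ t in Set.Ioi 0, Real.log (1 + t / x) * expOrderDensity N k μ t
        = 2 * Real.log 2 * lam N μ x k := by
  have hkN' : (k : ℝ) ≤ N := by exact_mod_cast hkN
  have hpos : ∀ b : ℕ, 0 < (N : ℝ) - k + 1 + b := fun b => by
    have : (0 : ℝ) ≤ b := b.cast_nonneg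
    linarith
  simp_rw [expOrderDensity_eq_sum hk hkN]
  obtain ⟨hint, hval⟩ := integral_log_mul_sum_exp_neg hx (Finset.range k)
    (fun b => (N.factorial : ℝ) / ((k - 1).factorial * (N - k).factorial)
        * (((k - 1).choose b : ℝ) * (-1) ^ b / μ))
    (fun b => ((N : ℝ) - k + 1 + b) / μ) fun b _ => div_pos (hpos b) hμ
  refine ⟨hint, hval.trans ?_⟩
  have hlog : Real.log 2 ≠ 0 := (Real.log_pos one_lt_two).ne'
  rw [lam, Finset.mul_sum, Finset.mul_sum]
  refine Finset.sum_congr rfl fun b _ => ?_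
  have := (hpos b).ne'
  rw [mul_div_assoc x]
  field_simp

lemma integral_log_mul_expOrderDensity_mul_expOrderCdf (hx : 0 < x) (hμ : 0 < μ) (hμ' : 0 < μ')
    (hk : 1 ≤ k) (hkN : k ≤ N) :
    IntegrableOn (fun t => Real.log (1 + t / x)
        * (expOrderDensity N k μ t * expOrderCdf N l μ' t)) (Set.Ioi 0) ∧
      ∫ t in Set.Ioi 0, Real.log (1 + t / x) * (expOrderDensity N k μ t * expOrderCdf N l μ' t)
        = 2 * Real.log 2 * nu N μ μ' x k l := by
  have hkN' : (k : ℝ) ≤ N := by exact_mod_cast hkN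
  have hpos : ∀ n d b : ℕ, n ∈ Finset.Icc l N →
      0 < ((N : ℝ) - k + 1 + b) / μ + ((N : ℝ) - n + d) / μ' := fun n d b hn => by
    have hb : (0 : ℝ) ≤ b := b.cast_nonneg
    have hd : (0 : ℝ) ≤ d := d.cast_nonneg
    have hnN : (n : ℝ) ≤ N := by exact_mod_cast (Finset.mem_Icc.mp hn).2
    have h1 : 0 < ((N : ℝ) - k + 1 + b) / μ := div_pos (by linarith) hμ
    have h2 : 0 ≤ ((N : ℝ) - n + d) / μ' := div_nonneg (by linarith) hμ'.le
    linarith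
  set s := (Finset.Icc l N).sigma fun n =>
    (Finset.range (n + 1)).sigma fun _ => Finset.range k with hs
  have hprod : ∀ t, expOrderDensity N k μ t * expOrderCdf N l μ' t = ∑ i ∈ s,
      (N.factorial : ℝ) / ((k - 1).factorial * (N - k).factorial)
        * ((N.choose i.1 : ℝ) * (i.1.choose i.2.1 : ℝ) * ((k - 1).choose i.2.2 : ℝ)
          * (-1) ^ (i.2.2 + i.2.1) / μ)
        * Real.exp (-((((N : ℝ) - k + 1 + i.2.2) / μ + ((N : ℝ) - i.1 + i.2.1) / μ') * t)) := by
    intro t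
    simp_rw [hs, Finset.sum_sigma, expOrderDensity_eq_sum hk hkN, expOrderCdf_eq_sum,
      Finset.mul_sum, Finset.sum_mul]
    refine Finset.sum_congr rfl fun n _ => Finset.sum_congr rfl fun d _ =>
      Finset.sum_congr rfl fun b _ => ?_
    rw [add_mul, neg_add, Real.exp_add, pow_add]
    ring
  simp_rw [hprod]
  obtain ⟨hint, hval⟩ := integral_log_mul_sum_exp_neg hx s
    (fun i => (N.factorial : ℝ) / ((k - 1).factorial * (N - k).factorial)
        * ((N.choose i.1 : ℝ) * (i.1.choose i.2.1 : ℝ) * ((k - 1).choose i.2.2 : ℝ)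
          * (-1) ^ (i.2.2 + i.2.1) / μ))
    (fun i => ((N : ℝ) - k + 1 + i.2.2) / μ + ((N : ℝ) - i.1 + i.2.1) / μ')
    fun i hi => hpos _ _ _ (Finset.mem_sigma.mp hi).1
  refine ⟨hint, hval.trans ?_⟩
  have hlog : Real.log 2 ≠ 0 := (Real.log_pos one_lt_two).ne'
  simp_rw [hs, Finset.sum_sigma, nu, Finset.mul_sum]
  refine Finset.sum_congr rfl fun n hn => Finset.sum_congr rfl fun d _ =>
    Finset.sum_congr rfl fun b _ => ?_
  have := (hpos n d b hn).ne'
  set K := ((N : ℝ) - k + 1 + b) / μ + ((N : ℝ) - n + d) / μ'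
  field_simp

lemma integral_survival_mul_survival_div_add (hx : 0 < x) (hμ : 0 < μ) (hμ' : 0 < μ')
    (hk : 1 ≤ k) (hkN : k ≤ N) (hl : 1 ≤ l) (hlN : l ≤ N) :
    ∫ t in Set.Ioi 0, (1 - expOrderCdf N k μ t) * (1 - expOrderCdf N l μ' t) * (1 / (x + t))
      = 2 * Real.log 2
        * (lam N μ x k - nu N μ μ' x k l + lam N μ' x l - nu N μ' μ x l k) := by
  have hderiv : ∀ t ∈ Set.Ici (0 : ℝ), HasDerivAt
      (fun t => Real.log (1 + t / x) * ((1 - expOrderCdf N k μ t) * (1 - expOrderCdf N l μ' t)))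
      ((1 - expOrderCdf N k μ t) * (1 - expOrderCdf N l μ' t) * (1 / (x + t))
        - (Real.log (1 + t / x) * expOrderDensity N k μ t
            - Real.log (1 + t / x) * (expOrderDensity N k μ t * expOrderCdf N l μ' t)
          + (Real.log (1 + t / x) * expOrderDensity N l μ' t
            - Real.log (1 + t / x) * (expOrderDensity N l μ' t * expOrderCdf N k μ t)))) t := by
    intro t ht
    refine ((hasDerivAt_log_one_add_div hx ht).mul
      (((hasDerivAt_expOrderCdf hk hkN t).const_sub 1).mul
        ((hasDerivAt_expOrderCdf hl hlN t).const_sub 1))).congr_deriv ?_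
    simp only [Pi.mul_apply]
    ring
  have hcont : ∀ {m : ℕ} {ν : ℝ}, 1 ≤ m → m ≤ N → Continuous (expOrderCdf N m ν) :=
    fun hm hmN => continuous_iff_continuousAt.mpr fun t =>
      (hasDerivAt_expOrderCdf hm hmN t).continuousAt
  have hbound : ∀ t, 0 ≤ t → (1 - expOrderCdf N k μ t) * (1 - expOrderCdf N l μ' t)
      ≤ 2 ^ N * Real.exp (-(1 / μ * t)) := fun t ht =>
    (mul_le_of_le_one_right (one_sub_expOrderCdf_mem_Icc hμ hkN ht).1
      (one_sub_expOrderCdf_mem_Icc hμ' hlN ht).2).trans (one_sub_expOrderCdf_le hμ hkN ht)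
  have hnonneg : ∀ t, 0 ≤ t → 0 ≤ (1 - expOrderCdf N k μ t) * (1 - expOrderCdf N l μ' t) :=
    fun t ht => mul_nonneg (one_sub_expOrderCdf_mem_Icc hμ hkN ht).1
      (one_sub_expOrderCdf_mem_Icc hμ' hlN ht).1
  have hint : IntegrableOn (fun t => (1 - expOrderCdf N k μ t) * (1 - expOrderCdf N l μ' t)
      * (1 / (x + t))) (Set.Ioi 0) := by
    have hmeas := (hcont (ν := μ) hk hkN).measurable
    have hmeas' := (hcont (ν := μ') hl hlN).measurable
    refine ((integrableOn_exp_neg_mul_div_add hx (one_div_pos.mpr hμ)).const_mul (2 ^ N)).mono'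
      (by fun_prop) ?_
    refine (ae_restrict_iff' measurableSet_Ioi).mpr (.of_forall fun t ht => ?_)
    have ht' : 0 < t := ht
    have hinv : 0 ≤ 1 / (x + t) := by positivity
    rw [Real.norm_of_nonneg (mul_nonneg (hnonneg t ht'.le) hinv)]
    calc _ ≤ 2 ^ N * Real.exp (-(1 / μ * t)) * (1 / (x + t)) :=
          mul_le_mul_of_nonneg_right (hbound t ht'.le) hinv
      _ = _ := by ring
  have htend : Filter.Tendsto (fun t => Real.log (1 + t / x)
      * ((1 - expOrderCdf N k μ t) * (1 - expOrderCdf N l μ' t))) Filter.atTop (nhds 0) := by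
    have h := (tendsto_log_mul_exp_neg_atTop hx (one_div_pos.mpr hμ)).const_mul (2 ^ N)
    rw [mul_zero] at h
    refine squeeze_zero' ?_ ?_ h
    · filter_upwards [Filter.eventually_ge_atTop 0] with t ht
      exact mul_nonneg (log_one_add_div_nonneg hx ht) (hnonneg t ht)
    · filter_upwards [Filter.eventually_ge_atTop 0] with t ht
      rw [mul_left_comm (2 ^ N)]
      exact mul_le_mul_of_nonneg_left (hbound t ht) (log_one_add_div_nonneg hx ht)
  obtain ⟨i1, v1⟩ := integral_log_mul_expOrderDensity hx hμ hk hkN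
  obtain ⟨i2, v2⟩ := integral_log_mul_expOrderDensity hx hμ' hl hlN
  obtain ⟨j1, w1⟩ :=
    integral_log_mul_expOrderDensity_mul_expOrderCdf (l := l) hx hμ hμ' hk hkN
  obtain ⟨j2, w2⟩ :=
    integral_log_mul_expOrderDensity_mul_expOrderCdf (l := k) hx hμ' hμ hl hlN
  have h := integral_Ioi_of_hasDerivAt_of_tendsto
    (hderiv 0 Set.self_mem_Ici).continuousAt.continuousWithinAt
    (fun t ht => hderiv t (Set.Ioi_subset_Ici_self ht))
    (hint.sub ((i1.sub j1).add (i2.sub j2))) htend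
  rw [integral_sub hint, integral_add, integral_sub i1 j1, integral_sub i2 j2, v1, v2, w1, w2] at h
  · simp only [zero_div, add_zero, Real.log_one, zero_mul, sub_zero] at h
    linarith
  · exact i1.sub j1
  · exact i2.sub j2
  · exact (i1.sub j1).add (i2.sub j2)

lemma measureReal_expMeasure_Iic (hμ : 0 < μ) (ht : 0 ≤ t) :
    (expMeasure (1 / μ)).real (Set.Iic t) = 1 - Real.exp (-(t / μ)) := by
  have := isProbabilityMeasure_expMeasure (one_div_pos.mpr hμ)
  rw [← cdf_eq_real, cdf_expMeasure_eq (one_div_pos.mpr hμ), if_pos ht, one_div_mul_eq_div]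

lemma measureReal_lt_orderStat (hμ : 0 < μ) (hk : 1 ≤ k) (hkN : k ≤ N) (ht : 0 ≤ t) :
    (Measure.pi fun _ : Fin N => expMeasure (1 / μ)).real {ω | t < orderStat ω k}
      = 1 - expOrderCdf N k μ t := by
  have := isProbabilityMeasure_expMeasure (one_div_pos.mpr hμ)
  have hcompl : {ω : Fin N → ℝ | t < orderStat ω k} = {ω | orderStat ω k ≤ t}ᶜ := by
    ext ω
    simp
  rw [hcompl, probReal_compl_eq_one_sub
      (measurableSet_le (measurable_orderStat hk hkN) measurable_const),
    measureReal_orderStat_le hk hkN, measureReal_expMeasure_Iic hμ ht, expOrderCdf]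

end ExponentialOrderStatistics

/-- Closed form of `Λ_G(ξ,η,x)`: the expected capacity `E[(1/2)log₂(1+min(Y¹_{(ξ)},Y²_{(η)})/x)]`
for the `ξ`-th and `η`-th order statistics of two independent families of `N` i.i.d.
exponentials with means `μ₁` and `μ₂`. -/
theorem stmt_17 (μ₁ μ₂ x : ℝ) (hμ₁ : 0 < μ₁) (hμ₂ : 0 < μ₂) (hx : 0 < x)
    (N ξ η : ℕ) (hN : 1 ≤ N) (hξ1 : 1 ≤ ξ) (hξN : ξ ≤ N) (hη1 : 1 ≤ η) (hηN : η ≤ N) :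
    ∫ ω : (Fin N → ℝ) × (Fin N → ℝ),
        (1 / 2) * Real.logb 2 (1 + min (orderStat ω.1 ξ) (orderStat ω.2 η) / x)
        ∂((Measure.pi fun _ : Fin N => expMeasure (1 / μ₁)).prod
          (Measure.pi fun _ : Fin N => expMeasure (1 / μ₂)))
      = lam N μ₁ x ξ - nu N μ₁ μ₂ x ξ η + lam N μ₂ x η - nu N μ₂ μ₁ x η ξ := by
  have := isProbabilityMeasure_expMeasure (one_div_pos.mpr hμ₁)
  have := isProbabilityMeasure_expMeasure (one_div_pos.mpr hμ₂)
  set P := (Measure.pi fun _ : Fin N => expMeasure (1 / μ₁)).prod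
    (Measure.pi fun _ : Fin N => expMeasure (1 / μ₂)) with hP
  set Y : (Fin N → ℝ) × (Fin N → ℝ) → ℝ :=
    fun ω => min (orderStat ω.1 ξ) (orderStat ω.2 η) with hY
  have hYm : Measurable Y := ((measurable_orderStat hξ1 hξN).comp measurable_fst).min
    ((measurable_orderStat hη1 hηN).comp measurable_snd)
  have hsurv : ∀ t, 0 ≤ t → P.real {ω | t < Y ω}
      = (1 - expOrderCdf N ξ μ₁ t) * (1 - expOrderCdf N η μ₂ t) := by
    intro t ht
    have hset : {ω | t < Y ω} = {ω : Fin N → ℝ | t < orderStat ω ξ} ×ˢ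
        {ω : Fin N → ℝ | t < orderStat ω η} := by
      ext ω
      simp [hY]
    rw [hset, hP, measureReal_prod_prod, measureReal_lt_orderStat hμ₁ hξ1 hξN ht,
      measureReal_lt_orderStat hμ₂ hη1 hηN ht]
  have hYpos : ∀ᵐ ω ∂P, 0 ≤ Y ω := by
    have hone : P {ω | 0 < Y ω} = 1 := by
      have h := hsurv 0 le_rfl
      rw [expOrderCdf_zero hξ1, expOrderCdf_zero hη1, sub_zero, one_mul] at h
      rw [← ofReal_measureReal, h, ENNReal.ofReal_one]
    filter_upwards [(mem_ae_iff_prob_eq_one (measurableSet_lt measurable_const hYm)).mpr hone]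
      with ω hω using le_of_lt hω
  have hint : ∀ y, 0 ≤ y → ∫ t in (0)..y, 1 / (x + t) = Real.log (1 + y / x) := by
    intro y hy
    have hsub : ∀ t ∈ Set.uIcc 0 y, 0 ≤ t := fun t ht => by
      rw [Set.uIcc_of_le hy] at ht
      exact ht.1
    rw [intervalIntegral.integral_eq_sub_of_hasDerivAt
      (fun t ht => hasDerivAt_log_one_add_div hx (hsub t ht))]
    · simp
    · refine ContinuousOn.intervalIntegrable fun t ht => ?_
      have := hsub t ht
      exact ContinuousAt.continuousWithinAt
        (ContinuousAt.div (by fun_prop) (by fun_prop) (by positivity))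
  have hlayer : ∫ ω, Real.log (1 + Y ω / x) ∂P
      = ∫ t in Set.Ioi 0, (1 - expOrderCdf N ξ μ₁ t) * (1 - expOrderCdf N η μ₂ t)
          * (1 / (x + t)) := by
    have hcake := lintegral_comp_eq_lintegral_meas_lt_mul (f := Y) (g := fun t => 1 / (x + t)) P
      hYpos hYm.aemeasurable
      (fun t ht => by
        refine ContinuousOn.intervalIntegrable fun s hs => ?_
        rw [Set.uIcc_of_le ht.le] at hs
        have := hs.1
        exact ContinuousAt.continuousWithinAt
          (ContinuousAt.div (by fun_prop) (by fun_prop) (by positivity)))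
      ((ae_restrict_iff' measurableSet_Ioi).mpr (.of_forall fun t ht => by
        have : 0 < t := ht
        positivity))
    have hcont : ∀ {m : ℕ} {ν : ℝ}, 1 ≤ m → m ≤ N → Measurable (expOrderCdf N m ν) :=
      fun hm hmN => (continuous_iff_continuousAt.mpr fun t =>
        (hasDerivAt_expOrderCdf hm hmN t).continuousAt).measurable
    have hm₁ := hcont (ν := μ₁) hξ1 hξN
    have hm₂ := hcont (ν := μ₂) hη1 hηN
    rw [integral_eq_lintegral_of_nonneg_ae
        (hYpos.mono fun ω hω => log_one_add_div_nonneg hx hω)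
        (Measurable.aestronglyMeasurable (by fun_prop)),
      integral_eq_lintegral_of_nonneg_ae
        ((ae_restrict_iff' measurableSet_Ioi).mpr (.of_forall fun t ht => by
          have ht' : 0 < t := ht
          exact mul_nonneg (hsurv t ht'.le ▸ measureReal_nonneg) (by positivity)))
        (by fun_prop)]
    congr 1
    have hlog : ∀ᵐ ω ∂P, ENNReal.ofReal (Real.log (1 + Y ω / x))
        = ENNReal.ofReal (∫ t in (0)..Y ω, 1 / (x + t)) :=
      hYpos.mono fun ω hω => by rw [hint _ hω]
    rw [lintegral_congr_ae hlog, hcake]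
    refine setLIntegral_congr_fun measurableSet_Ioi fun t ht => ?_
    have ht' : 0 < t := ht
    simp only [← hsurv t ht'.le]
    rw [ENNReal.ofReal_mul measureReal_nonneg, ofReal_measureReal]
  have hlog : Real.log 2 ≠ 0 := (Real.log_pos one_lt_two).ne'
  simp_rw [Real.logb]
  rw [integral_const_mul, integral_div, hlayer,
    integral_survival_mul_survival_div_add hx hμ₁ hμ₂ hξ1 hξN hη1 hηN]
  field_simp
end
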